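/- Suppose f : ℝ^p → ℝ satisfies Assumption (KL-MR), and set ρ = β / max{θ(β+2), 1}. Then there exists C > 0 such that for every ε ∈ [0, ε̄] and every set S ⊆ ℝ^p that is positively invariant for the ε-biased gradient dynamics (i.e., for every z ∈ S there exists an ε-biased gradient curve x of f on [0,∞) with x(0) = z and x(t) ∈ S for all t ≥ 0) and satisfies f(S) ⊆ vcrit_ε f, every z ∈ S satisfies dist(z, crit f) ≤ C ε^ρ. -/

import Mathlib

open Filter MeasureTheory Metric Set Topology
open scoped ENNReal NNReal

abbrev Ep (p : ℕ) := EuclideanSpace ℝ (Fin p)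

def critSet {p : ℕ} (f : Ep p → ℝ) (ε : ℝ) : Set (Ep p) := {x | ‖gradient f x‖ ≤ ε}

def vcritSet {p : ℕ} (f : Ep p → ℝ) (ε : ℝ) : Set ℝ := f '' critSet f ε

/-- An `ε`-biased gradient curve of `f` on the interval `I ⊆ [0,∞)`: a locally Lipschitz
curve on `I` which is differentiable a.e. on `I` with `‖x'(t) + ∇f(x(t))‖ ≤ ε`. -/
def IsBiasedGradCurve {p : ℕ} (f : Ep p → ℝ) (ε : ℝ) (I : Set ℝ) (x : ℝ → Ep p) : Prop :=
  (∀ t ∈ I, ∃ K : NNReal, ∃ s ∈ nhdsWithin t I, LipschitzOnWith K x s) ∧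
  ∀ᵐ t ∂(volume.restrict I), DifferentiableAt ℝ x t ∧ ‖deriv x t + gradient f (x t)‖ ≤ ε

theorem sub_le_of_infDist_le {s : Set ℝ} (hs : s.Finite) (hne : s.Nonempty) {a b r : ℝ}
    (hr : 0 ≤ r) (h : ∀ v ∈ Icc a b, infDist v s ≤ r) : b - a ≤ s.ncard * (2 * r) := by
  have hsub : Icc a b ⊆ ⋃ y ∈ hs.toFinset, closedBall y r := by
    intro v hv
    obtain ⟨y, hy, hvy⟩ := hs.isCompact.exists_infDist_eq_dist hne v
    simp only [mem_iUnion]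
    exact ⟨y, hs.mem_toFinset.2 hy, hvy.symm.trans_le (h v hv)⟩
  have hvol := (measure_mono (μ := volume) hsub).trans (measure_biUnion_finset_le _ _)
  simp only [Real.volume_Icc, Real.volume_closedBall, Finset.sum_const, nsmul_eq_mul] at hvol
  rw [← Set.ncard_eq_toFinset_card s hs, ← ENNReal.ofReal_natCast,
    ← ENNReal.ofReal_mul (by positivity)] at hvol
  exact (ENNReal.ofReal_le_ofReal_iff (by positivity)).1 hvol

theorem AbsolutelyContinuousOnInterval.le_of_ae_deriv_nonpos {φ : ℝ → ℝ} {a b : ℝ}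
    (hφ : AbsolutelyContinuousOnInterval φ a b) (hab : a ≤ b)
    (h : ∀ᵐ t ∂(volume.restrict (Icc a b)), deriv φ t ≤ 0) : φ b ≤ φ a := by
  have hint := hφ.integral_deriv_eq_sub
  have := intervalIntegral.integral_mono_ae_restrict hab hφ.intervalIntegrable_deriv
    (intervalIntegrable_const (c := (0 : ℝ))) h
  simp only [intervalIntegral.integral_zero] at this
  linarith

namespace IsBiasedGradCurve

variable {p : ℕ} {f : Ep p → ℝ} {ε : ℝ} {x : ℝ → Ep p}

theorem continuousOn (hx : IsBiasedGradCurve f ε (Ici 0) x) : ContinuousOn x (Ici 0) :=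
  LocallyLipschitzOn.continuousOn fun t ht => hx.1 t ht

theorem add_inner_add_mul_le (hf : Differentiable ℝ f) {L : ℝ≥0} (hL : LipschitzWith L f)
    (hx : IsBiasedGradCurve f ε (Ici 0) x) {g T a : ℝ} (hT : 0 ≤ T)
    (hg : ∀ t ∈ Icc 0 T, g ≤ ‖gradient f (x t)‖) (w : Ep p)
    (hw : ∀ y v : Ep p, g ≤ ‖y‖ → ‖v + y‖ ≤ ε → inner ℝ (y + w) v + a ≤ 0) :
    f (x T) + inner ℝ w (x T) + a * T ≤ f (x 0) + inner ℝ w (x 0) := by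
  have hsub : Icc 0 T ⊆ Ici (0 : ℝ) := Icc_subset_Ici_self
  have hloc : LocallyLipschitzOn (Icc 0 T) x :=
    LocallyLipschitzOn.mono (fun t ht => hx.1 t ht) hsub
  obtain ⟨K, hK⟩ := hloc.exists_lipschitzOnWith_of_compact isCompact_Icc
  rw [← uIcc_of_le hT] at hK
  have hfx := (hL.comp_lipschitzOnWith hK).absolutelyContinuousOnInterval
  have hwx := ((innerSL ℝ w).lipschitz.comp_lipschitzOnWith hK).absolutelyContinuousOnInterval
  have hid := (LipschitzWith.id.lipschitzOnWith
    (s := uIcc 0 T)).absolutelyContinuousOnInterval.const_mul a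
  have hle := ((hfx.add hwx).add hid).le_of_ae_deriv_nonpos hT ?_
  · simpa [add_assoc] using hle
  · filter_upwards [ae_restrict_of_ae_restrict_of_subset hsub hx.2,
      ae_restrict_mem measurableSet_Icc] with t ⟨hd, hb⟩ ht
    have h1 : HasDerivAt (f ∘ x) (inner ℝ (gradient f (x t)) (deriv x t)) t := by
      simpa using (hf (x t)).hasGradientAt.hasFDerivAt.comp_hasDerivAt t hd.hasDerivAt
    have h2 : HasDerivAt (innerSL ℝ w ∘ x) (inner ℝ w (deriv x t)) t := by
      simpa using (innerSL ℝ w).hasFDerivAt.comp_hasDerivAt t hd.hasDerivAt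
    have h3 : HasDerivAt (fun t : ℝ => a * id t) a t := by
      simpa using (hasDerivAt_id t).const_mul a
    have h4 := ((h1.add h2).add h3).deriv
    have h5 := hw _ _ (hg t ht) hb
    rw [inner_add_left] at h5
    exact h4.trans_le h5

theorem inner_gradient_le {y v : Ep p} (h : ‖v + y‖ ≤ ε) : inner ℝ y v ≤ ε * ‖y‖ - ‖y‖ ^ 2 := by
  have h1 : inner ℝ y v = inner ℝ y (v + y) - ‖y‖ ^ 2 := by
    rw [inner_add_right, real_inner_self_eq_norm_sq]; ring
  have h2 := (real_inner_le_norm y (v + y)).trans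
    (mul_le_mul_of_nonneg_left h (norm_nonneg y))
  linarith

theorem add_sq_mul_le (hf : Differentiable ℝ f) {L : ℝ≥0} (hL : LipschitzWith L f)
    (hx : IsBiasedGradCurve f ε (Ici 0) x) {g T : ℝ} (hT : 0 ≤ T) (hg0 : 0 ≤ g)
    (hεg : 2 * ε ≤ g) (hg : ∀ t ∈ Icc 0 T, g ≤ ‖gradient f (x t)‖) :
    f (x T) + g ^ 2 / 2 * T ≤ f (x 0) := by
  have := hx.add_inner_add_mul_le hf hL (a := g ^ 2 / 2) hT hg 0 fun y v hy hv => by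
    have := inner_gradient_le hv
    rw [add_zero]
    nlinarith
  simpa using this

theorem add_mul_norm_le (hf : Differentiable ℝ f) {L : ℝ≥0} (hL : LipschitzWith L f)
    (hx : IsBiasedGradCurve f ε (Ici 0) x) {g T : ℝ} (hT : 0 ≤ T) (hg0 : 0 ≤ g)
    (hεg : 2 * ε ≤ g) (hg : ∀ t ∈ Icc 0 T, g ≤ ‖gradient f (x t)‖) :
    f (x T) + g / 3 * ‖x T - x 0‖ ≤ f (x 0) := by
  set d := x T - x 0 with hd
  have hu : ‖‖d‖⁻¹ • d‖ ≤ 1 := by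
    rw [norm_smul, norm_inv, norm_norm]
    exact inv_mul_le_one
  have hud : inner ℝ (‖d‖⁻¹ • d) d = ‖d‖ := by
    rw [real_inner_smul_left, real_inner_self_eq_norm_sq]
    rcases eq_or_ne ‖d‖ 0 with h | h
    · simp [h]
    · field_simp
  have := hx.add_inner_add_mul_le hf hL (a := 0) hT hg ((g / 3) • (‖d‖⁻¹ • d))
    fun y v hy hv => by
      have h1 := inner_gradient_le hv
      have h2 : ‖v‖ ≤ ε + ‖y‖ := by
        have := norm_sub_le (v + y) y
        rw [add_sub_cancel_right] at this
        linarith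
      have h3 : inner ℝ (‖d‖⁻¹ • d) v ≤ ε + ‖y‖ := (real_inner_le_norm _ _).trans <|
        (mul_le_of_le_one_left (norm_nonneg v) hu).trans h2
      rw [inner_add_left, real_inner_smul_left, add_zero]
      have h4 := mul_le_mul_of_nonneg_left h3 (div_nonneg hg0 zero_le_three)
      nlinarith
  rw [hd, inner_sub_right, ← hd] at hud
  simp only [real_inner_smul_left] at this hud
  linear_combination this - g / 3 * hud

/-- If the gradient is at least `g` wherever the distance to `A` exceeds half its initial value
`D`, and the values of `f` drop by at most `M` along the curve, then `g * D ≤ 6 * M`. -/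
theorem mul_infDist_le (hf : Differentiable ℝ f) {L : ℝ≥0} (hL : LipschitzWith L f)
    (hx : IsBiasedGradCurve f ε (Ici 0) x) {A : Set (Ep p)} {g M : ℝ} (hg0 : 0 < g)
    (hεg : 2 * ε ≤ g)
    (hg : ∀ t, 0 ≤ t → infDist (x 0) A / 2 ≤ infDist (x t) A → g ≤ ‖gradient f (x t)‖)
    (hM : ∀ t, 0 ≤ t → f (x 0) - f (x t) ≤ M) : g * infDist (x 0) A ≤ 6 * M := by
  set D := infDist (x 0) A with hD
  have hD0 : 0 ≤ D := infDist_nonneg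
  have hM0 : 0 ≤ M := by simpa using hM 0 le_rfl
  set Z := Ici (0 : ℝ) ∩ (fun t => infDist (x t) A) ⁻¹' Iic (D / 2) with hZ
  have hZc : IsClosed Z :=
    ((continuous_infDist_pt A).comp_continuousOn hx.continuousOn).preimage_isClosed_of_isClosed
      isClosed_Ici isClosed_Iic
  have hZne : Z.Nonempty := by
    by_contra hcon
    rw [not_nonempty_iff_eq_empty] at hcon
    have hT : 0 ≤ 2 * (M + 1) / g ^ 2 := by positivity
    have h1 := hx.add_sq_mul_le hf hL hT hg0.le hεg fun t ht => hg t ht.1 <| by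
      by_contra hlt
      have : t ∈ Z := ⟨ht.1, (not_le.1 hlt).le⟩
      simp [hcon] at this
    have h2 := hM _ hT
    have h3 : g ^ 2 / 2 * (2 * (M + 1) / g ^ 2) = M + 1 := by field_simp
    linarith
  have hZb : BddBelow Z := ⟨0, fun t ht => ht.1⟩
  obtain ⟨hT0, hTD⟩ : sInf Z ∈ Z := hZc.csInf_mem hZne hZb
  have hcont : ContinuousOn (fun t => infDist (x t) A) (Icc 0 (sInf Z)) :=
    (continuous_infDist_pt A).comp_continuousOn (hx.continuousOn.mono Icc_subset_Ici_self)
  have hge : ∀ t ∈ Icc 0 (sInf Z), D / 2 ≤ infDist (x t) A := by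
    intro t ht
    by_contra! hlt
    have hmem : D / 2 ∈ Icc (infDist (x t) A) (infDist (x 0) A) := ⟨hlt.le, by linarith⟩
    obtain ⟨s, hs, hsD⟩ := intermediate_value_Icc' ht.1
      (hcont.mono (Icc_subset_Icc_right ht.2)) hmem
    have hsZ : sInf Z ≤ s := csInf_le hZb ⟨hs.1, hsD.le⟩
    have hst : s = t := le_antisymm hs.2 (ht.2.trans hsZ)
    subst hst
    exact hlt.ne hsD
  have h1 := hx.add_mul_norm_le hf hL hT0 hg0.le hεg fun t ht => hg t ht.1 (hge t ht)
  have h2 := hM _ hT0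
  have h3 : D ≤ infDist (x (sInf Z)) A + dist (x 0) (x (sInf Z)) := infDist_le_infDist_add_dist
  rw [dist_comm, dist_eq_norm] at h3
  have h4 : D / 2 ≤ ‖x (sInf Z) - x 0‖ := by
    have : infDist (x (sInf Z)) A ≤ D / 2 := hTD
    linarith
  nlinarith

end IsBiasedGradCurve

theorem critSet_mono {p : ℕ} (f : Ep p → ℝ) : Monotone (critSet f) :=
  fun _ _ h _ hy => le_trans hy h

theorem vcritSet_mono {p : ℕ} (f : Ep p → ℝ) : Monotone (vcritSet f) :=
  fun _ _ h => image_mono (critSet_mono f h)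

theorem stmt6 {p : ℕ} (f : Ep p → ℝ) (hf : ContDiff ℝ 1 f)
    (L : ℝ≥0) (hL : 0 < L) (hLip : LipschitzWith L f)
    (hvc_ne : (vcritSet f 0).Nonempty) (hvc_fin : (vcritSet f 0).Finite)
    (εb : ℝ) (hεb0 : 0 < εb) (hεb1 : εb < 1)
    (hsegs : ∀ ε : ℝ, 0 ≤ ε → ε ≤ εb → ∃ (n : ℕ) (a b : Fin n → ℝ),
      vcritSet f ε = ⋃ i, Set.Icc (a i) (b i))
    (c θ β : ℝ) (hc : 0 < c) (hθ0 : 0 ≤ θ) (hθ1 : θ < 1) (hβ : 0 < β)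
    (hKL : ∀ y : Ep p, f y ∈ vcritSet f εb →
      (infDist (f y) (vcritSet f 0)) ^ θ ≤ c * ‖gradient f y‖)
    (hMR : ∀ y : Ep p, f y ∈ vcritSet f εb →
      infDist y (critSet f 0) ≤ c * ‖gradient f y‖ ^ β)
    (ρ : ℝ) (hρ : ρ = β / max (θ * (β + 2)) 1)
    :
    ∃ C : ℝ, 0 < C ∧ ∀ ε : ℝ, 0 ≤ ε → ε ≤ εb →
      ∀ S : Set (Ep p),
        (∀ z ∈ S, ∃ x : ℝ → Ep p, IsBiasedGradCurve f ε (Set.Ici 0) x ∧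
          x 0 = z ∧ ∀ t : ℝ, 0 ≤ t → x t ∈ S) →
        f '' S ⊆ vcritSet f ε →
        ∀ z ∈ S, infDist z (critSet f 0) ≤ C * ε ^ ρ := by
  obtain ⟨y₀, hy₀⟩ : (critSet f 0).Nonempty := hvc_ne.of_image
  have hθ : 0 < θ := by
    refine hθ0.lt_of_ne' fun h => ?_
    have h1 := hKL y₀ (vcritSet_mono f hεb0.le ⟨y₀, hy₀, rfl⟩)
    have h2 : ‖gradient f y₀‖ = 0 := le_antisymm hy₀ (norm_nonneg _)
    rw [h, Real.rpow_zero, h2, mul_zero] at h1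
    linarith
  have hfd : Differentiable ℝ f := hf.differentiable (by norm_num)
  have hmax : 0 < max (θ * (β + 2)) 1 := lt_max_of_lt_right one_pos
  have hρ0 : 0 ≤ ρ := by rw [hρ]; positivity
  have hρβ : ρ ≤ β := hρ ▸ div_le_self hβ.le (le_max_right _ _)
  have hρ' : ρ ≤ 1 / θ * (β / (β + 1)) := by
    have h1 : θ * (β + 1) ≤ max (θ * (β + 2)) 1 :=
      (mul_le_mul_of_nonneg_left (by linarith) hθ0).trans (le_max_left _ _)
    have h2 : 1 / θ * (β / (β + 1)) = β / (θ * (β + 1)) := by field_simp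
    rw [hρ, h2]
    exact div_le_div_of_nonneg_left hβ.le (by positivity) h1
  set N : ℝ := ((vcritSet f 0).ncard : ℝ) with hN
  have hN0 : 0 ≤ N := Nat.cast_nonneg _
  set K : ℝ := 6 * N * c ^ (1 / θ) / c with hK
  have hK0 : 0 ≤ K := by positivity
  refine ⟨2 * c * 2 ^ β + 2 * c * K ^ (β / (β + 1)), by positivity,
    fun ε hε0 hεb S hS hSv z hz => ?_⟩
  have hε1 : ε ≤ 1 := hεb.trans hεb1.le
  have hclose : ∀ v ∈ vcritSet f ε, infDist v (vcritSet f 0) ≤ (c * ε) ^ (1 / θ) := by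
    rintro _ ⟨y, hy, rfl⟩
    rw [one_div, Real.le_rpow_inv_iff_of_pos infDist_nonneg (by positivity) hθ]
    exact (hKL y (vcritSet_mono f hεb ⟨y, hy, rfl⟩)).trans (mul_le_mul_of_nonneg_left hy hc.le)
  obtain ⟨x, hx, rfl, hxS⟩ := hS z hz
  have hxv : ∀ t, 0 ≤ t → f (x t) ∈ vcritSet f ε := fun t ht => hSv ⟨_, hxS t ht, rfl⟩
  have hdrop : ∀ t, 0 ≤ t → f (x 0) - f (x t) ≤ N * (2 * (c * ε) ^ (1 / θ)) := by
    intro t ht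
    refine sub_le_of_infDist_le hvc_fin hvc_ne (by positivity) fun v hv => hclose v ?_
    obtain ⟨s, hs, rfl⟩ := intermediate_value_Icc' ht
      (hf.continuous.comp_continuousOn (hx.continuousOn.mono Icc_subset_Ici_self)) hv
    exact hxv s hs.1
  set D := infDist (x 0) (critSet f 0) with hD
  have hD0 : 0 ≤ D := infDist_nonneg
  set g := (D / (2 * c)) ^ (1 / β) with hg
  have hg0 : 0 ≤ g := by positivity
  have hDg : D = 2 * c * g ^ β := by
    rw [hg, ← Real.rpow_mul (by positivity), one_div_mul_cancel hβ.ne', Real.rpow_one]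
    field_simp
  rw [add_mul]
  by_cases hgε : g ≤ 2 * ε
  · have h1 : g ^ β ≤ 2 ^ β * ε ^ ρ := calc
      g ^ β ≤ (2 * ε) ^ β := Real.rpow_le_rpow hg0 hgε hβ.le
      _ = 2 ^ β * ε ^ β := Real.mul_rpow zero_le_two hε0
      _ ≤ 2 ^ β * ε ^ ρ := by
        gcongr ?_ * ?_
        exact Real.rpow_le_rpow_of_exponent_ge' hε0 hε1 hρ0 hρβ
    have h2 : 0 ≤ 2 * c * K ^ (β / (β + 1)) * ε ^ ρ := by positivity
    have h3 := mul_le_mul_of_nonneg_left h1 (show 0 ≤ 2 * c by positivity)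
    linarith
  · push Not at hgε
    have hgpos : 0 < g := by linarith
    have hgrad : ∀ t, 0 ≤ t → D / 2 ≤ infDist (x t) (critSet f 0) →
        g ≤ ‖gradient f (x t)‖ := by
      intro t ht h
      have h1 := h.trans (hMR (x t) (vcritSet_mono f hεb (hxv t ht)))
      rw [hg, one_div, Real.rpow_inv_le_iff_of_pos (by positivity) (norm_nonneg _) hβ,
        div_le_iff₀ (by positivity)]
      linarith
    have h1 := hx.mul_infDist_le hfd hLip hgpos hgε.le hgrad hdrop
    rw [← hD, hDg, Real.mul_rpow hc.le hε0] at h1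
    have h2 : g ^ (β + 1) ≤ K * ε ^ (1 / θ) := by
      rw [Real.rpow_add_one hgpos.ne', hK, div_mul_eq_mul_div, le_div_iff₀ hc]
      linarith
    have h3 : g ^ β ≤ K ^ (β / (β + 1)) * ε ^ ρ := calc
      g ^ β = (g ^ (β + 1)) ^ (β / (β + 1)) := by
        rw [← Real.rpow_mul hg0, mul_div_cancel₀ _ (by positivity)]
      _ ≤ (K * ε ^ (1 / θ)) ^ (β / (β + 1)) := Real.rpow_le_rpow (by positivity) h2 (by positivity)
      _ = K ^ (β / (β + 1)) * ε ^ (1 / θ * (β / (β + 1))) := by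
        rw [Real.mul_rpow hK0 (by positivity), ← Real.rpow_mul hε0]
      _ ≤ K ^ (β / (β + 1)) * ε ^ ρ := by
        gcongr ?_ * ?_
        exact Real.rpow_le_rpow_of_exponent_ge' hε0 hε1 hρ0 hρ'
    have h4 : 0 ≤ 2 * c * 2 ^ β * ε ^ ρ := by positivity
    have h5 := mul_le_mul_of_nonneg_left h3 (show 0 ≤ 2 * c by positivity)
    linarith
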